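/- Let k ≥ 2 be an integer, α ∈ ℝ and β ∈ ℝ∖ℤ, and for n ∈ ℕ let a_n(β) be the n-th derivative at t = 0 of t ↦ 1/(1 − e^{−t} e^{2πiβ}). Define 𝓕_k(x; α, β) := Σ_{p=1}^∞ e^{2πiαp} p^{1−k} ψ_β(px) for x ∈ ℂ∖(−∞, 0], where ψ_β(y) := lim_{N→∞} Σ_{q=0}^{N} e^{2πiβq}/(y+q); this series converges absolutely. Then for every δ ∈ (0, π) and every N ∈ ℕ, 𝓕_k(x; α, β) − Σ_{n=0}^{N−1} a_n(β) · Li_{k+n}(e^{2πiα}) · x^{−(n+1)} = O(|x|^{−(N+1)}) as |x| → ∞ within the sector {x ∈ ℂ∖{0} : |arg(x)| ≤ π − δ}. -/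

import Mathlib

open Complex MeasureTheory Filter Topology Set Asymptotics

noncomputable section

/-- `e2pi θ = e^{2πiθ}`. -/
def e2pi (θ : ℝ) : ℂ := Complex.exp (2 * Real.pi * Complex.I * θ)

/-- Polylogarithm of integer order: `Li 0 z = z/(1-z)`, `Li 1 z = -Log(1-z)`,
`Li m z = ∑_{n≥1} z^n/n^m` for `m ≥ 2`. -/
def Li : ℕ → ℂ → ℂ
  | 0, z => z / (1 - z)
  | 1, z => -Complex.log (1 - z)
  | (m+2), z => ∑' n : ℕ, z ^ (n+1) / ((n+1 : ℕ) : ℂ) ^ (m+2)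

/-- `a_n(β)`: the `n`-th derivative at `t = 0` of `t ↦ 1/(1 - e^{-t} e^{2πiβ})`. -/
def aCoeff (n : ℕ) (β : ℝ) : ℂ :=
  iteratedDeriv n (fun t : ℂ => (1 - Complex.exp (-t) * e2pi β)⁻¹) 0

/-- `ψ_β(x) = ∑_{q≥0} e^{2πiβq}/(x+q)`, summed as the limit of its partial sums. -/
def psiBeta (β : ℝ) (x : ℂ) : ℂ :=
  limUnder atTop (fun N : ℕ => ∑ q ∈ Finset.range (N + 1), e2pi (β * q) / (x + q))

/-- The higher Herglotz–Zagier–Novikov function on the cut plane, as the series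
`𝓕_k(x; α, β) = ∑_{p≥1} e^{2πiαp} p^{1-k} ψ_β(px)`. -/
def HHZNseries (k : ℕ) (x : ℂ) (α β : ℝ) : ℂ :=
  ∑' p : ℕ, e2pi ((p + 1) * α) * ((p + 1 : ℕ) : ℂ) ^ ((1 : ℤ) - k) * psiBeta β ((p + 1) * x)

/-- The filter of `x → ∞` within the sector `|arg x| ≤ π - δ`. -/
def sectorAtInfty (δ : ℝ) : Filter ℂ :=
  comap (norm : ℂ → ℝ) atTop ⊓ 𝓟 {x : ℂ | x ≠ 0 ∧ |Complex.arg x| ≤ Real.pi - δ}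

theorem norm_e2pi (θ : ℝ) : ‖e2pi θ‖ = 1 := by
  rw [e2pi, show (2 * Real.pi * Complex.I * θ : ℂ) = ((2 * Real.pi * θ : ℝ) : ℂ) * Complex.I by
    push_cast; ring]
  exact Complex.norm_exp_ofReal_mul_I _

theorem e2pi_mul_natCast (θ : ℝ) (q : ℕ) : e2pi (θ * q) = e2pi θ ^ q := by
  rw [e2pi, e2pi, ← Complex.exp_nat_mul]
  congr 1
  push_cast
  ring

theorem e2pi_ne_one {β : ℝ} (hβ : ∀ n : ℤ, β ≠ n) : e2pi β ≠ 1 := by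
  rw [e2pi, Ne, Complex.exp_eq_one_iff]
  rintro ⟨n, hn⟩
  refine hβ n ?_
  have h : (2 * Real.pi * Complex.I : ℂ) ≠ 0 := Complex.two_pi_I_ne_zero
  have : (β : ℂ) = (n : ℂ) := mul_left_cancel₀ h (by rw [hn]; ring)
  exact_mod_cast this

/-- The recurrence encoded by `G = 1 + e^{2πiβ} e^{-t} G` for `G(t) = 1/(1 - e^{-t} e^{2πiβ})`. -/
theorem aCoeff_eq {β : ℝ} (hβ : ∀ n : ℤ, β ≠ n) (n : ℕ) :
    aCoeff n β = (if n = 0 then 1 else 0) + e2pi β *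
      ∑ i ∈ Finset.range (n + 1), aCoeff i β * ((-1) ^ (n - i) * (n.choose i : ℂ)) := by
  set G : ℂ → ℂ := fun t => (1 - Complex.exp (-t) * e2pi β)⁻¹ with hG
  have h0 : (1 - Complex.exp (-0) * e2pi β) ≠ 0 := by
    simpa [sub_eq_zero] using (e2pi_ne_one hβ).symm
  have hF : ContDiff ℂ n fun t : ℂ => 1 - Complex.exp (-t) * e2pi β := by fun_prop
  have hGd : ContDiffAt ℂ n G 0 := hF.contDiffAt.inv h0
  have hE : ContDiff ℂ n fun t : ℂ => Complex.exp (-1 * t) := by fun_prop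
  have hev : G =ᶠ[𝓝 0] fun t => 1 + e2pi β * (G t * Complex.exp (-1 * t)) := by
    have hc : ContinuousAt (fun t : ℂ => 1 - Complex.exp (-t) * e2pi β) 0 :=
      hF.continuous.continuousAt
    filter_upwards [hc.eventually_ne h0] with t ht
    simp only [hG, neg_one_mul]
    field_simp
    ring
  have hadd : iteratedDeriv n (fun t => 1 + e2pi β * (G t * Complex.exp (-1 * t))) 0 =
      iteratedDeriv n (fun _ : ℂ => (1 : ℂ)) 0 +
        iteratedDeriv n (fun t => e2pi β * (G t * Complex.exp (-1 * t))) 0 :=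
    iteratedDeriv_fun_add contDiffAt_const
      (contDiffAt_const.mul (hGd.mul hE.contDiffAt))
  change iteratedDeriv n G 0 = _
  rw [hev.iteratedDeriv_eq n, hadd, iteratedDeriv_const, iteratedDeriv_const_mul_field,
    iteratedDeriv_fun_mul hGd hE.contDiffAt]
  congr 2
  refine Finset.sum_congr rfl fun i _ => ?_
  rw [iteratedDeriv_cexp_const_mul]
  simp only [mul_zero, Complex.exp_zero, mul_one, aCoeff]
  ring

/-- Taylor expansion of `(1 + u)^{-(n+1)}` at the origin with remainder. -/
theorem inv_one_add_pow_sub_isBigO (n L : ℕ) :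
    (fun u : ℂ => ((1 + u)⁻¹) ^ (n + 1) -
        ∑ m ∈ Finset.range L, (-1) ^ m * ((n + m).choose n : ℂ) * u ^ m)
      =O[𝓝 0] fun u => u ^ L := by
  have h := (Complex.one_div_one_sub_pow_hasFPowerSeriesOnBall_zero
    n).hasFPowerSeriesAt.isBigO_sub_partialSum_pow L
  have ht : Tendsto (fun u : ℂ => -u) (𝓝 0) (𝓝 0) := by
    simpa using (continuous_neg (G := ℂ)).tendsto 0
  have h' := h.comp_tendsto ht
  refine IsBigO.trans (IsBigO.congr_left h' fun u => ?_) ?_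
  swap
  · exact IsBigO.of_bound 1 (Eventually.of_forall fun u => by simp)
  simp only [Function.comp_apply, zero_add, sub_neg_eq_add, one_div, inv_pow,
    FormalMultilinearSeries.partialSum, FormalMultilinearSeries.ofScalars_apply_eq, smul_eq_mul]
  congr 1
  refine Finset.sum_congr rfl fun m _ => ?_
  rw [neg_pow]
  ring

/-- The truncated expansion `∑_{n<N} a_n(β) y^{-(n+1)}` of `ψ_β`. -/
def psiExpansion (β : ℝ) (N : ℕ) (y : ℂ) : ℂ :=
  ∑ n ∈ Finset.range N, aCoeff n β * y⁻¹ ^ (n + 1)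

/-- The defect of the truncated expansion in the equation `ψ_β(y) - e^{2πiβ} ψ_β(y+1) = 1/y`. -/
def psiDefect (β : ℝ) (N : ℕ) (y : ℂ) : ℂ :=
  y⁻¹ - psiExpansion β N y + e2pi β * psiExpansion β N (y + 1)

theorem psiDefect_polynomial_part {β : ℝ} (hβ : ∀ n : ℤ, β ≠ n) (N : ℕ) (u : ℂ) :
    ∑ n ∈ Finset.range (N + 1), aCoeff n β * u ^ (n + 1) = u + e2pi β *
      ∑ n ∈ Finset.range (N + 1), aCoeff n β * (u ^ (n + 1) *
        ∑ m ∈ Finset.range (N + 1 - n), (-1) ^ m * ((n + m).choose n : ℂ) * u ^ m) := by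
  have key : ∑ n ∈ Finset.range (N + 1), aCoeff n β * (u ^ (n + 1) *
        ∑ m ∈ Finset.range (N + 1 - n), (-1) ^ m * ((n + m).choose n : ℂ) * u ^ m) =
      ∑ M ∈ Finset.range (N + 1), (∑ i ∈ Finset.range (M + 1),
        aCoeff i β * ((-1) ^ (M - i) * (M.choose i : ℂ))) * u ^ (M + 1) := by
    have h := Finset.sum_range_diag_flip (N + 1) fun n m =>
      aCoeff n β * (u ^ (n + 1) * ((-1) ^ m * ((n + m).choose n : ℂ) * u ^ m))
    simp only [Finset.mul_sum]
    rw [← h]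
    refine Finset.sum_congr rfl fun M _ => ?_
    rw [Finset.sum_mul]
    refine Finset.sum_congr rfl fun i hi => ?_
    have hi' : i ≤ M := Nat.lt_succ_iff.mp (Finset.mem_range.mp hi)
    obtain ⟨j, rfl⟩ := Nat.exists_eq_add_of_le hi'
    rw [Nat.add_sub_cancel_left]
    ring
  rw [key, Finset.mul_sum]
  have hu : ∑ M ∈ Finset.range (N + 1), (if M = 0 then 1 else 0) * u ^ (M + 1) = u := by
    simp
  conv_rhs => lhs; rw [← hu]
  rw [← Finset.sum_add_distrib]
  refine Finset.sum_congr rfl fun M _ => ?_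
  conv_lhs => rw [aCoeff_eq hβ M]
  ring

theorem psiDefect_isBigO {β : ℝ} (hβ : ∀ n : ℤ, β ≠ n) (N : ℕ) :
    (fun u : ℂ => u - ∑ n ∈ Finset.range (N + 1), aCoeff n β * u ^ (n + 1) + e2pi β *
      ∑ n ∈ Finset.range (N + 1), aCoeff n β * (u ^ (n + 1) * ((1 + u)⁻¹) ^ (n + 1)))
      =O[𝓝 0] fun u => u ^ (N + 2) := by
  have h : (fun u : ℂ => e2pi β * ∑ n ∈ Finset.range (N + 1), aCoeff n β * (u ^ (n + 1) *
      (((1 + u)⁻¹) ^ (n + 1) - ∑ m ∈ Finset.range (N + 1 - n),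
        (-1) ^ m * ((n + m).choose n : ℂ) * u ^ m))) =O[𝓝 0] fun u => u ^ (N + 2) := by
    refine IsBigO.const_mul_left (IsBigO.fun_sum fun n hn => IsBigO.const_mul_left ?_ _) _
    have hn' : n < N + 1 := Finset.mem_range.mp hn
    refine ((isBigO_refl (fun u : ℂ => u ^ (n + 1)) (𝓝 0)).mul
      (inv_one_add_pow_sub_isBigO n (N + 1 - n))).congr_right fun u => ?_
    rw [← pow_add]
    congr 1
    omega
  refine h.congr_left fun u => ?_
  rw [psiDefect_polynomial_part hβ N u]
  simp only [mul_sub, Finset.sum_sub_distrib]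
  ring

theorem exists_norm_psiDefect_le {β : ℝ} (hβ : ∀ n : ℤ, β ≠ n) (N : ℕ) :
    ∃ C R : ℝ, 0 < C ∧ 1 ≤ R ∧ ∀ y : ℂ, R ≤ ‖y‖ →
      ‖psiDefect β (N + 1) y‖ ≤ C * (‖y‖⁻¹) ^ (N + 2) := by
  obtain ⟨C, hC, hb⟩ := (psiDefect_isBigO hβ N).exists_pos
  obtain ⟨ε, hε, hball⟩ := Metric.eventually_nhds_iff.mp hb.bound
  refine ⟨C, max 2 (2 / ε), hC, le_trans (by norm_num) (le_max_left _ _), fun y hy => ?_⟩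
  have hy2 : 2 ≤ ‖y‖ := (le_max_left _ _).trans hy
  have hyε : 2 / ε ≤ ‖y‖ := (le_max_right _ _).trans hy
  have hypos : 0 < ‖y‖ := by linarith
  have hy0 : y ≠ 0 := norm_pos_iff.mp hypos
  have hd : dist y⁻¹ 0 < ε := by
    rw [dist_zero_right, norm_inv, inv_lt_comm₀ hypos hε]
    refine lt_of_lt_of_le ?_ hyε
    rw [div_eq_mul_inv]
    have := inv_pos.mpr hε
    linarith
  have h := hball hd
  have hinv : (y + 1)⁻¹ = y⁻¹ * (1 + y⁻¹)⁻¹ := by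
    rw [← mul_inv, mul_add, mul_one, mul_inv_cancel₀ hy0]
  rw [norm_pow, norm_inv] at h
  refine le_trans (le_of_eq ?_) h
  simp only [psiDefect, psiExpansion, hinv, mul_pow]

theorem exists_mul_norm_add_le_norm_add {δ : ℝ} (hδ : 0 < δ) (hδπ : δ ≤ Real.pi) :
    ∃ c : ℝ, 0 < c ∧ ∀ y : ℂ, |Complex.arg y| ≤ Real.pi - δ → ∀ s : ℝ, 0 ≤ s →
      c * (‖y‖ + s) ≤ ‖y + s‖ := by
  have hκ : Real.cos δ < 1 := by
    simpa using Real.cos_lt_cos_of_nonneg_of_le_pi le_rfl hδπ hδ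
  refine ⟨√((1 - Real.cos δ) / 2), Real.sqrt_pos.mpr (by linarith), fun y hy s hs => ?_⟩
  have hre : -(‖y‖ * Real.cos δ) ≤ y.re := by
    have hcos : -Real.cos δ ≤ Real.cos (Complex.arg y) := by
      rw [← Real.cos_pi_sub, ← Real.cos_abs (Complex.arg y)]
      exact Real.cos_le_cos_of_nonneg_of_le_pi (abs_nonneg _) (by linarith) hy
    rw [← Complex.norm_mul_cos_arg y]
    nlinarith [norm_nonneg y]
  have hsq : ‖y + s‖ ^ 2 = ‖y‖ ^ 2 + s ^ 2 + 2 * s * y.re := by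
    rw [Complex.sq_norm, Complex.sq_norm, Complex.normSq_apply, Complex.normSq_apply]
    simp
    ring
  refine le_of_sq_le_sq ?_ (norm_nonneg _)
  rw [mul_pow, Real.sq_sqrt (by linarith), hsq]
  have h1 : 0 ≤ (1 + Real.cos δ) * (‖y‖ - s) ^ 2 :=
    mul_nonneg (by linarith [Real.neg_one_le_cos δ]) (sq_nonneg _)
  have h2 : -(‖y‖ * Real.cos δ) * s ≤ y.re * s := mul_le_mul_of_nonneg_right hre hs
  nlinarith

theorem sum_psi_eq (β : ℝ) (N : ℕ) (y : ℂ) (Q : ℕ) :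
    ∑ q ∈ Finset.range Q, e2pi (β * q) / (y + q) =
      psiExpansion β N y - e2pi β ^ Q * psiExpansion β N (y + Q) +
        ∑ q ∈ Finset.range Q, e2pi β ^ q * psiDefect β N (y + q) := by
  induction Q with
  | zero => simp
  | succ Q ih =>
    rw [Finset.sum_range_succ, Finset.sum_range_succ, ih, e2pi_mul_natCast, psiDefect]
    push_cast
    rw [add_assoc y]
    ring

theorem tendsto_psiExpansion_add_natCast (β : ℝ) (N : ℕ) (y : ℂ) :
    Tendsto (fun Q : ℕ => psiExpansion β N (y + Q)) atTop (𝓝 0) := by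
  have h : Tendsto (fun Q : ℕ => (y + Q : ℂ)⁻¹) atTop (𝓝 0) :=
    tendsto_inv₀_cobounded.comp
      (tendsto_const_add_cobounded y |>.comp tendsto_natCast_atTop_cobounded)
  have h' : Tendsto (fun Q : ℕ => psiExpansion β N (y + Q)) atTop
      (𝓝 (∑ n ∈ Finset.range N, aCoeff n β * 0 ^ (n + 1))) :=
    tendsto_finsetSum _ fun n _ => (h.pow (n + 1)).const_mul _
  simpa using h'

theorem psiBeta_eq {β : ℝ} {N : ℕ} {y : ℂ}
    (hs : Summable fun q : ℕ => e2pi β ^ q * psiDefect β N (y + q)) :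
    psiBeta β y = psiExpansion β N y + ∑' q : ℕ, e2pi β ^ q * psiDefect β N (y + q) := by
  refine Tendsto.limUnder_eq ?_
  suffices h : Tendsto (fun Q : ℕ => ∑ q ∈ Finset.range Q, e2pi (β * q) / (y + q)) atTop
      (𝓝 (psiExpansion β N y + ∑' q : ℕ, e2pi β ^ q * psiDefect β N (y + q))) from
    h.comp (tendsto_add_atTop_nat 1)
  have h0 : Tendsto (fun Q : ℕ => e2pi β ^ Q * psiExpansion β N (y + Q)) atTop (𝓝 0) := by
    refine squeeze_zero_norm (fun Q => le_of_eq ?_)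
      (tendsto_zero_iff_norm_tendsto_zero.mp (tendsto_psiExpansion_add_natCast β N y))
    simp [norm_e2pi]
  simp only [sum_psi_eq β N y]
  simpa using (h0.const_sub (psiExpansion β N y)).add hs.hasSum.tendsto_sum_nat

theorem summable_inv_natCast_succ_sq : Summable fun q : ℕ => (((q : ℝ) + 1)⁻¹) ^ 2 := by
  have h := (summable_nat_add_iff 1).mpr (Real.summable_nat_pow_inv.mpr (one_lt_two))
  simpa using h

theorem inv_add_pow_le {r : ℝ} (hr : 1 ≤ r) (q m : ℕ) :
    ((r + q)⁻¹) ^ (m + 2) ≤ (r⁻¹) ^ m * (((q : ℝ) + 1)⁻¹) ^ 2 := by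
  have hq : (0 : ℝ) ≤ q := Nat.cast_nonneg q
  rw [pow_add]
  have h1 : (r + q)⁻¹ ≤ r⁻¹ := inv_anti₀ (by linarith) (by linarith)
  have h2 : (r + q)⁻¹ ≤ ((q : ℝ) + 1)⁻¹ := inv_anti₀ (by linarith) (by linarith)
  gcongr

/-- Uniform asymptotic expansion of `ψ_β` in a sector. -/
theorem exists_norm_psiBeta_sub_le {β : ℝ} (hβ : ∀ n : ℤ, β ≠ n) {δ : ℝ} (hδ : 0 < δ)
    (hδπ : δ ≤ Real.pi) (N : ℕ) :
    ∃ C R : ℝ, 0 ≤ C ∧ 1 ≤ R ∧ ∀ y : ℂ, R ≤ ‖y‖ → |Complex.arg y| ≤ Real.pi - δ →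
      ‖psiBeta β y - psiExpansion β N y‖ ≤ C * (‖y‖⁻¹) ^ (N + 1) := by
  obtain ⟨c, hc, hsec⟩ := exists_mul_norm_add_le_norm_add hδ hδπ
  obtain ⟨C, R, hC, hR, hdef⟩ := exists_norm_psiDefect_le hβ (N + 1)
  set S : ℝ := ∑' q : ℕ, (((q : ℝ) + 1)⁻¹) ^ 2
  set K : ℝ := C * (c⁻¹) ^ (N + 3) with hK
  have hK0 : 0 ≤ K := by positivity
  have hS0 : 0 ≤ S := tsum_nonneg fun q => by positivity
  refine ⟨‖aCoeff N β‖ + ‖aCoeff (N + 1) β‖ + K * S, max 1 (R / c), by positivity,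
    le_max_left _ _, fun y hy harg => ?_⟩
  have hy1 : 1 ≤ ‖y‖ := (le_max_left _ _).trans hy
  have hyR : R ≤ c * ‖y‖ := by
    have := (le_max_right _ _).trans hy
    rwa [div_le_iff₀' hc] at this
  have hterm (q : ℕ) : ‖e2pi β ^ q * psiDefect β (N + 2) (y + q)‖ ≤
      K * (‖y‖⁻¹) ^ (N + 1) * (((q : ℝ) + 1)⁻¹) ^ 2 := by
    have hq : (0 : ℝ) ≤ q := Nat.cast_nonneg q
    have hs := hsec y harg q hq
    rw [Complex.ofReal_natCast] at hs
    have hpos : 0 < c * (‖y‖ + q) := by positivity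
    have hRle : R ≤ ‖y + q‖ := by nlinarith
    rw [norm_mul, norm_pow, norm_e2pi, one_pow, one_mul]
    calc ‖psiDefect β (N + 2) (y + q)‖ ≤ C * (‖y + q‖⁻¹) ^ (N + 3) := hdef _ hRle
      _ ≤ C * ((c * (‖y‖ + q))⁻¹) ^ (N + 3) := by gcongr
      _ = K * ((‖y‖ + q)⁻¹) ^ (N + 1 + 2) := by rw [mul_inv, mul_pow, hK]; ring
      _ ≤ K * ((‖y‖⁻¹) ^ (N + 1) * (((q : ℝ) + 1)⁻¹) ^ 2) := by
        gcongr
        exact inv_add_pow_le hy1 q (N + 1)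
      _ = _ := by ring
  have hg := summable_inv_natCast_succ_sq.hasSum.mul_left (K * (‖y‖⁻¹) ^ (N + 1))
  have hsum : Summable fun q : ℕ => e2pi β ^ q * psiDefect β (N + 2) (y + q) :=
    Summable.of_norm_bounded hg.summable hterm
  have htail := tsum_of_norm_bounded hg hterm
  rw [psiBeta_eq hsum]
  have hexp : psiExpansion β (N + 2) y = psiExpansion β N y + aCoeff N β * y⁻¹ ^ (N + 1) +
      aCoeff (N + 1) β * y⁻¹ ^ (N + 2) := by
    simp only [psiExpansion, Finset.sum_range_succ]
  rw [hexp, add_assoc, add_assoc, add_sub_cancel_left]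
  have hinv : ‖y‖⁻¹ ≤ 1 := inv_le_one_of_one_le₀ hy1
  have hpow : (‖y‖⁻¹) ^ (N + 2) ≤ (‖y‖⁻¹) ^ (N + 1) :=
    pow_le_pow_of_le_one (by positivity) hinv (by omega)
  calc _ ≤ ‖aCoeff N β * y⁻¹ ^ (N + 1)‖ + (‖aCoeff (N + 1) β * y⁻¹ ^ (N + 2)‖ +
        ‖∑' q : ℕ, e2pi β ^ q * psiDefect β (N + 2) (y + q)‖) :=
        (norm_add_le _ _).trans (by gcongr; exact norm_add_le _ _)
    _ ≤ ‖aCoeff N β‖ * ‖y‖⁻¹ ^ (N + 1) + (‖aCoeff (N + 1) β‖ * ‖y‖⁻¹ ^ (N + 1) +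
        K * (‖y‖⁻¹) ^ (N + 1) * S) := by
        simp only [norm_mul, norm_pow, norm_inv]
        gcongr
    _ = _ := by ring

theorem norm_natCast_succ_mul (p : ℕ) (x : ℂ) :
    ‖((p : ℂ) + 1) * x‖ = ((p : ℝ) + 1) * ‖x‖ := by
  rw [norm_mul]
  norm_cast

theorem HHZN_weight_eq (j : ℕ) (α : ℝ) (p : ℕ) :
    e2pi ((p + 1) * α) * ((p + 1 : ℕ) : ℂ) ^ ((1 : ℤ) - (j + 2 : ℕ)) =
      e2pi α ^ (p + 1) * (((p + 1 : ℕ) : ℂ)⁻¹) ^ (j + 1) := by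
  have he := e2pi_mul_natCast α (p + 1)
  push_cast at he
  rw [mul_comm, mul_comm _ α, he, show ((1 : ℤ) - (j + 2 : ℕ)) = -((j + 1 : ℕ) : ℤ) by
    push_cast; ring, zpow_neg, zpow_natCast, inv_pow, mul_comm]

theorem norm_HHZN_weight_mul_le (j : ℕ) (α : ℝ) (p : ℕ) {C : ℝ} {N : ℕ} {x w : ℂ}
    (hw : ‖w‖ ≤ C * (‖((p : ℂ) + 1) * x‖⁻¹) ^ (N + 1)) :
    ‖e2pi ((p + 1) * α) * ((p + 1 : ℕ) : ℂ) ^ ((1 : ℤ) - (j + 2 : ℕ)) * w‖ ≤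
      C * (‖x‖⁻¹) ^ (N + 1) * (((p : ℝ) + 1)⁻¹) ^ 2 := by
  have hp : (0 : ℝ) ≤ p := Nat.cast_nonneg p
  have hP1 : ((p : ℝ) + 1)⁻¹ ≤ 1 := inv_le_one_of_one_le₀ (by linarith)
  have hCx : 0 ≤ C * (‖x‖⁻¹) ^ (N + 1) := by
    have h := (norm_nonneg w).trans hw
    rw [norm_natCast_succ_mul, mul_inv, mul_pow, mul_left_comm] at h
    exact nonneg_of_mul_nonneg_right h (by positivity)
  have hnorm : ‖((p + 1 : ℕ) : ℂ)‖ = (p : ℝ) + 1 := by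
    rw [Complex.norm_natCast]
    push_cast
    rfl
  rw [HHZN_weight_eq, norm_mul, norm_mul, norm_pow, norm_pow, norm_e2pi, one_pow, one_mul,
    norm_inv, hnorm]
  calc _ ≤ (((p : ℝ) + 1)⁻¹) ^ (j + 1) * (C * (‖((p : ℂ) + 1) * x‖⁻¹) ^ (N + 1)) := by gcongr
    _ = C * (‖x‖⁻¹) ^ (N + 1) * (((p : ℝ) + 1)⁻¹) ^ (j + N + 2) := by
      rw [norm_natCast_succ_mul, mul_inv, mul_pow]
      ring
    _ ≤ _ := mul_le_mul_of_nonneg_left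
      (pow_le_pow_of_le_one (by positivity) hP1 (by omega)) hCx

theorem hasSum_Li (m : ℕ) {z : ℂ} (hz : ‖z‖ = 1) :
    HasSum (fun p : ℕ => z ^ (p + 1) / ((p + 1 : ℕ) : ℂ) ^ (m + 2)) (Li (m + 2) z) := by
  refine (Summable.of_norm_bounded summable_inv_natCast_succ_sq fun p => ?_).hasSum
  have hp : (0 : ℝ) ≤ p := Nat.cast_nonneg p
  rw [norm_div, norm_pow, norm_pow, hz, one_pow, one_div, Complex.norm_natCast, ← inv_pow]
  push_cast
  exact pow_le_pow_of_le_one (by positivity) (inv_le_one_of_one_le₀ (by linarith)) (by omega)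

theorem hasSum_HHZN_weight_mul_psiExpansion (j : ℕ) (α β : ℝ) (N : ℕ) (x : ℂ) :
    HasSum (fun p : ℕ => e2pi ((p + 1) * α) * ((p + 1 : ℕ) : ℂ) ^ ((1 : ℤ) - (j + 2 : ℕ)) *
        psiExpansion β N (((p : ℂ) + 1) * x))
      (∑ n ∈ Finset.range N, aCoeff n β * Li (j + 2 + n) (e2pi α) * x ^ (-(n + 1) : ℤ)) := by
  have h := hasSum_sum (s := Finset.range N) fun n _ =>
    ((hasSum_Li (j + n) (norm_e2pi α)).mul_left (aCoeff n β)).mul_right (x ^ (-(n + 1) : ℤ))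
  simp only [add_right_comm j _ 2] at h
  refine h.congr_fun fun p => ?_
  rw [HHZN_weight_eq, psiExpansion, Finset.mul_sum]
  refine Finset.sum_congr rfl fun n _ => ?_
  rw [show (-(n + 1) : ℤ) = -((n + 1 : ℕ) : ℤ) by push_cast; rfl, zpow_neg, zpow_natCast,
    mul_inv, mul_pow, div_eq_mul_inv]
  push_cast
  simp only [← inv_pow]
  ring

/-- Asymptotic expansion of `𝓕_k(x; α, β)` for `k ≥ 2`, `β ∉ ℤ`: the defining series converges
absolutely on the cut plane, and for each `δ ∈ (0,π)`, `N`,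
`𝓕_k(x;α,β) - ∑_{n<N} a_n(β) Li_{k+n}(e^{2πiα}) x^{-(n+1)} = O(|x|^{-(N+1)})` as `|x| → ∞` in
the sector `|arg x| ≤ π - δ`. -/
theorem HHZN_asymptotic (k : ℕ) (hk : 2 ≤ k) (α β : ℝ) (hβ : ∀ n : ℤ, β ≠ n) :
    (∀ x ∈ Complex.slitPlane,
      Summable (fun p : ℕ =>
        ‖e2pi ((p + 1) * α) * ((p + 1 : ℕ) : ℂ) ^ ((1 : ℤ) - k) * psiBeta β ((p + 1) * x)‖)) ∧
    ∀ δ : ℝ, 0 < δ → δ < Real.pi → ∀ N : ℕ,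
      (fun x : ℂ => HHZNseries k x α β -
          ∑ n ∈ Finset.range N, aCoeff n β * Li (k + n) (e2pi α) * x ^ (-(n + 1) : ℤ))
        =O[sectorAtInfty δ]
      (fun x : ℂ => ‖x‖ ^ (-(N + 1) : ℤ)) := by
  obtain ⟨j, rfl⟩ : ∃ j, k = j + 2 := ⟨k - 2, by omega⟩
  have harg (x : ℂ) (p : ℕ) : Complex.arg (((p : ℂ) + 1) * x) = Complex.arg x := by
    simpa using Complex.arg_real_mul x (r := (p : ℝ) + 1) (by positivity)
  constructor
  · intro x hx
    obtain ⟨hxarg, hx0⟩ := Complex.mem_slitPlane_iff_arg.mp hx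
    have hlt : |Complex.arg x| < Real.pi :=
      abs_lt.mpr ⟨Complex.neg_pi_lt_arg x, lt_of_le_of_ne (Complex.arg_le_pi x) hxarg⟩
    obtain ⟨C, R, -, -, hpsi⟩ := exists_norm_psiBeta_sub_le hβ (δ := Real.pi - |Complex.arg x|)
      (by linarith) (by linarith [abs_nonneg (Complex.arg x)]) 0
    refine Summable.of_norm_bounded_eventually_nat
      (summable_inv_natCast_succ_sq.mul_left (C * (‖x‖⁻¹) ^ (0 + 1))) ?_
    have hlarge : ∀ᶠ p : ℕ in atTop, R / ‖x‖ ≤ p :=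
      tendsto_natCast_atTop_atTop.eventually_ge_atTop _
    filter_upwards [hlarge] with p hp
    rw [norm_norm]
    have hRle : R ≤ ‖((p : ℂ) + 1) * x‖ := by
      rw [norm_natCast_succ_mul]
      rw [div_le_iff₀ (norm_pos_iff.mpr hx0)] at hp
      linarith [norm_nonneg x]
    have h := hpsi _ hRle (by rw [harg]; linarith)
    simpa [psiExpansion] using norm_HHZN_weight_mul_le j α p h
  · intro δ hδ hδπ N
    obtain ⟨C, R, hC, hR, hpsi⟩ := exists_norm_psiBeta_sub_le hβ hδ hδπ.le N
    set S : ℝ := ∑' q : ℕ, (((q : ℝ) + 1)⁻¹) ^ 2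
    refine IsBigO.of_bound (C * S) ?_
    have hlarge : ∀ᶠ x : ℂ in sectorAtInfty δ, R ≤ ‖x‖ :=
      (tendsto_comap.eventually_ge_atTop R).filter_mono inf_le_left
    have hsector : ∀ᶠ x : ℂ in sectorAtInfty δ, x ≠ 0 ∧ |Complex.arg x| ≤ Real.pi - δ :=
      (eventually_principal.mpr fun _ h => h).filter_mono inf_le_right
    filter_upwards [hlarge, hsector] with x hxR hx
    have hterm (p : ℕ) := norm_HHZN_weight_mul_le j α p (hpsi (((p : ℂ) + 1) * x)
      (by
        rw [norm_natCast_succ_mul]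
        nlinarith [norm_nonneg x, (Nat.cast_nonneg p : (0 : ℝ) ≤ p)])
      (by rw [harg]; exact hx.2))
    have hg := summable_inv_natCast_succ_sq.hasSum.mul_left (C * (‖x‖⁻¹) ^ (N + 1))
    have hrem := (Summable.of_norm_bounded hg.summable hterm).hasSum
    have hbound := tsum_of_norm_bounded hg hterm
    have htotal := (hrem.add (hasSum_HHZN_weight_mul_psiExpansion j α β N x)).tsum_eq
    have hseries : HHZNseries (j + 2) x α β = _ :=
      (tsum_congr fun p => by ring).trans htotal
    rw [hseries, add_sub_cancel_right]
    refine hbound.trans (le_of_eq ?_)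
    rw [norm_zpow, norm_norm, zpow_neg, inv_pow, ← Nat.cast_add_one, zpow_natCast]
    ring

end
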